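/- Let C be a nonempty finite index set, let a : C → ℝ with a_j > 0 for all j ∈ C, and let b be a real number with 0 < b < ∑_{j∈C} a_j. Then there exists a unique real number ā > 0 such that ∑_{j∈C} min(a_j, ā) = b. -/

import Mathlib

theorem sum_min_lt_sum_min {C : Type*} [Fintype C] (a : C → ℝ) {s t : ℝ} (hst : s < t)
    (hs : ∑ j, min (a j) s < ∑ j, a j) : ∑ j, min (a j) s < ∑ j, min (a j) t := by
  obtain ⟨i, hi, hlt⟩ := Finset.exists_lt_of_sum_lt hs
  have hsi : s < a i := by simpa using hlt
  refine Finset.sum_lt_sum (fun j _ => min_le_min_left _ hst.le) ⟨i, hi, ?_⟩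
  rw [min_eq_right hsi.le]
  exact lt_min hsi hst

/-- Existence and uniqueness of the lifting threshold `ā`: for a nonempty finite index
set with positive weights `a j` and `0 < b < ∑ j, a j`, there is a unique `ā > 0` such
that `∑ j, min (a j) ā = b`. -/
theorem exists_unique_lifting_threshold {C : Type*} [Fintype C] [Nonempty C]
    (a : C → ℝ) (ha : ∀ j, 0 < a j) (b : ℝ) (hb0 : 0 < b) (hb : b < ∑ j, a j) :
    ∃! abar : ℝ, 0 < abar ∧ ∑ j, min (a j) abar = b := by
  have hzero : ∑ j, min (a j) 0 = 0 :=
    Finset.sum_eq_zero fun j _ => min_eq_right (ha j).le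
  have htop : ∑ j, min (a j) (∑ i, a i) = ∑ j, a j :=
    Finset.sum_congr rfl fun j hj =>
      min_eq_left (Finset.single_le_sum (fun i _ => (ha i).le) hj)
  have hcont : Continuous fun x : ℝ => ∑ j, min (a j) x := by fun_prop
  obtain ⟨x, hx, hxb⟩ := intermediate_value_Ioo (hb0.trans hb).le hcont.continuousOn
    (show b ∈ Set.Ioo _ _ from ⟨hzero.trans_lt hb0, hb.trans_eq htop.symm⟩)
  refine ⟨x, ⟨hx.1, hxb⟩, fun y ⟨_, hyb⟩ => ?_⟩
  dsimp only at hxb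
  rcases lt_trichotomy y x with h | h | h
  · exact absurd (hyb.trans hxb.symm) (sum_min_lt_sum_min a h (hyb.trans_lt hb)).ne
  · exact h
  · exact absurd (hxb.trans hyb.symm) (sum_min_lt_sum_min a h (hxb.trans_lt hb)).ne
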